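/- Let R^11 be the profile ≽_1: c,a,{b,d}; ≽_2: b,{a,c},d; ≽_3: a,d,{b,c}; ≽_4: {b,c},a,d. Then f(R^11)(d) = 0 and f(R^11)(b) ≥ 1/2. -/

import Mathlib

open Finset
open scoped Classical

section Framework

variable {A : Type*} [Fintype A] {n : ℕ}

/-- `p` is a lottery (probability distribution) on the set of alternatives `A`. -/
def IsLottery (p : A → ℝ) : Prop := (∀ x, 0 ≤ p x) ∧ ∑ x, p x = 1

/-- `r` is a weak preference relation: complete (total) and transitive. -/
def IsPref (r : A → A → Prop) : Prop := Total r ∧ Transitive r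

/-- A preference profile assigns a weak preference relation to each of the `n` agents. -/
def IsProfile (R : Fin n → A → A → Prop) : Prop := ∀ i, IsPref (R i)

/-- The probability that `p` assigns to alternatives weakly preferred (by `r`) to `x`. -/
noncomputable def upperProb (r : A → A → Prop) (p : A → ℝ) (x : A) : ℝ :=
  ∑ y ∈ univ.filter (fun y => r y x), p y

/-- Stochastic dominance: `p ≽^sd q` w.r.t. the preference relation `r`. -/
def SDge (r : A → A → Prop) (p q : A → ℝ) : Prop :=
  ∀ x, upperProb r q x ≤ upperProb r p x

/-- Strict stochastic dominance: `p ≻^sd q` w.r.t. the preference relation `r`. -/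
def SDgt (r : A → A → Prop) (p q : A → ℝ) : Prop :=
  SDge r p q ∧ ¬ SDge r q p

/-- A social decision scheme maps every preference profile to a lottery. -/
def IsSDS (f : (Fin n → A → A → Prop) → (A → ℝ)) : Prop :=
  ∀ R : Fin n → A → A → Prop, IsProfile R → IsLottery (f R)

/-- Anonymity: invariance under permutations of the agents. -/
def Anonymous (f : (Fin n → A → A → Prop) → (A → ℝ)) : Prop :=
  ∀ R : Fin n → A → A → Prop, IsProfile R → ∀ π : Equiv.Perm (Fin n),
    f (fun i => R (π i)) = f R

/-- Neutrality: `f(R^σ)(σ x) = f(R)(x)`, where `R^σ` relabels alternatives by `σ`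
(i.e. `σ x ≽^σ_i σ y ↔ x ≽_i y`). -/
def Neutral (f : (Fin n → A → A → Prop) → (A → ℝ)) : Prop :=
  ∀ R : Fin n → A → A → Prop, IsProfile R → ∀ σ : Equiv.Perm A, ∀ x : A,
    f (fun i u v => R i (σ.symm u) (σ.symm v)) (σ x) = f R x

/-- The lottery `p` is sd-efficient for the profile `R`: no lottery `q` is weakly
sd-preferred to `p` by all agents and strictly sd-preferred by some agent. -/
def SDEfficientLottery (R : Fin n → A → A → Prop) (p : A → ℝ) : Prop :=
  ¬ ∃ q : A → ℝ, IsLottery q ∧ (∀ i, SDge (R i) q p) ∧ (∃ i, SDgt (R i) q p)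

/-- sd-efficiency of a social decision scheme. -/
def SDEfficient (f : (Fin n → A → A → Prop) → (A → ℝ)) : Prop :=
  ∀ R : Fin n → A → A → Prop, IsProfile R → SDEfficientLottery R (f R)

/-- sd-strategyproofness: no agent can misreport and obtain a strictly
sd-preferred lottery. -/
def SDStrategyproof (f : (Fin n → A → A → Prop) → (A → ℝ)) : Prop :=
  ∀ R R' : Fin n → A → A → Prop, IsProfile R → IsProfile R' → ∀ i : Fin n,
    (∀ j, j ≠ i → R j = R' j) → ¬ SDgt (R i) (f R') (f R)

/-- `x` is the unique most-preferred alternative of the relation `r`. -/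
def UniqueTop (r : A → A → Prop) (x : A) : Prop :=
  ∀ y, y ≠ x → r x y ∧ ¬ r y x

/-- `f` extends random dictatorship: whenever every agent has a unique top choice,
each alternative gets probability (number of agents having it as top)/n. -/
def ExtendsRD (f : (Fin n → A → A → Prop) → (A → ℝ)) : Prop :=
  ∀ R : Fin n → A → A → Prop, IsProfile R →
    ∀ t : Fin n → A, (∀ i, UniqueTop (R i) (t i)) →
      ∀ x : A, f R x = ((univ.filter (fun i => t i = x)).card : ℝ) / (n : ℝ)

/-- `x` is Pareto-dominated in the profile `R`. -/
def Pareto_Dominated (R : Fin n → A → A → Prop) (x : A) : Prop :=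
  ∃ y : A, (∀ i, R i y x) ∧ ∃ i, R i y x ∧ ¬ R i x y

end Framework

/-! Concrete setting: alternatives `A = {a,b,c,d}` encoded as `Fin 4`. -/

/-- The alternative `a`. -/ def a : Fin 4 := 0
/-- The alternative `b`. -/ def b : Fin 4 := 1
/-- The alternative `c`. -/ def c : Fin 4 := 2
/-- The alternative `d`. -/ def d : Fin 4 := 3

/-- The weak preference relation induced by a rank function over `(a,b,c,d)`
(lower rank = more preferred; equal ranks = indifference). -/
def pr (rk : Fin 4 → ℕ) : Fin 4 → Fin 4 → Prop := fun x y => rk x ≤ rk y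


/-- The profile `R11`: ≽₁: c,a,{b,d}; ≽₂: b,{a,c},d; ≽₃: a,d,{b,c}; ≽₄: {b,c},a,d. -/
def R11 : Fin 4 → Fin 4 → Fin 4 → Prop :=
  ![pr ![1,2,0,2], pr ![1,0,1,2], pr ![0,2,2,1], pr ![1,0,0,2]]

section Lotteries

variable {A : Type*} [Fintype A] {n : ℕ}

theorem upperProb_add (r : A → A → Prop) (p q : A → ℝ) (x : A) :
    upperProb r (p + q) x = upperProb r p x + upperProb r q x := by
  simp [upperProb, sum_add_distrib]

theorem upperProb_sub (r : A → A → Prop) (p q : A → ℝ) (x : A) :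
    upperProb r (p - q) x = upperProb r p x - upperProb r q x := by
  simp [upperProb, sum_sub_distrib]

theorem upperProb_single (r : A → A → Prop) (y : A) (t : ℝ) (x : A) :
    upperProb r (Pi.single y t) x = if r y x then t else 0 := by
  simp [upperProb, Pi.single_apply]

/-- No feasible shift of an sd-efficient lottery weakly benefits all agents and strictly
benefits one of them. -/
theorem SDEfficientLottery.upperProb_shift_le {R : Fin n → A → A → Prop} {p v : A → ℝ}
    (heff : SDEfficientLottery R p) (hp : IsLottery p) (hpv : ∀ x, 0 ≤ p x + v x)
    (hv : ∑ x, v x = 0) (hge : ∀ i x, 0 ≤ upperProb (R i) v x) (i : Fin n) (x : A) :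
    upperProb (R i) v x ≤ 0 := by
  by_contra! hpos
  have hsd : ∀ j, SDge (R j) (p + v) p := fun j z => by
    rw [upperProb_add]; linarith [hge j z]
  refine heff ⟨p + v, ⟨hpv, ?_⟩, hsd, i, hsd i, fun h => ?_⟩
  · simp [sum_add_distrib, hp.2, hv]
  · have := h x
    rw [upperProb_add] at this
    linarith

theorem SDEfficientLottery.eq_zero_of_pareto_dominated {R : Fin n → A → A → Prop} {p : A → ℝ}
    {x : A} (heff : SDEfficientLottery R p) (hp : IsLottery p) (hR : IsProfile R)
    (hx : Pareto_Dominated R x) : p x = 0 := by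
  obtain ⟨y, hyx, i, -, hxy⟩ := hx
  have hne : x ≠ y := fun h => hxy (h ▸ hyx i)
  have key := heff.upperProb_shift_le (v := Pi.single y (p x) - Pi.single x (p x)) hp
    (fun z => by
      have hz := hp.1 z
      have hx0 := hp.1 x
      by_cases h1 : z = x
      · subst h1; simp [hne]
      · by_cases h2 : z = y
        · subst h2; simpa [h1] using add_nonneg hz hx0
        · simpa [h1, h2] using hz)
    (by simp [sum_sub_distrib])
    (fun j z => by
      rw [upperProb_sub, upperProb_single, upperProb_single]
      by_cases h : R j x z
      · simp [h, (hR j).2 (hyx j) h]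
      · simpa [h] using ite_nonneg (hp.1 x) le_rfl) i y
  have hyy : R i y y := ((hR i).1 y y).elim id id
  rw [upperProb_sub, upperProb_single, upperProb_single, if_pos hyy, if_neg hxy] at key
  linarith [hp.1 x]

end Lotteries

/-- An anonymous and neutral scheme respects every symmetry of a profile. -/
theorem apply_eq_of_symmetry {A : Type*} {n : ℕ}
    {f : (Fin n → A → A → Prop) → (A → ℝ)}
    (han : Anonymous f) (hneu : Neutral f) {R : Fin n → A → A → Prop} (hR : IsProfile R)
    (π : Equiv.Perm (Fin n)) (σ : Equiv.Perm A)
    (h : ∀ i u v, R (π i) (σ u) (σ v) ↔ R i u v) (x : A) :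
    f R (σ x) = f R x := by
  have hRσ : (fun i u v => R i (σ.symm u) (σ.symm v)) = fun i => R (π i) := by
    funext i u v
    simpa using propext (h i (σ.symm u) (σ.symm v)).symm
  rw [← hneu R hR σ x, hRσ, han R hR π]

/-- The preference profile given by the rank functions `rk i`. -/
def rankProfile (rk : Fin 4 → Fin 4 → ℕ) : Fin 4 → Fin 4 → Fin 4 → Prop := fun i => pr (rk i)

theorem isProfile_rankProfile (rk : Fin 4 → Fin 4 → ℕ) : IsProfile (rankProfile rk) :=
  fun _ => ⟨fun _ _ => le_total _ _, fun _ _ _ => le_trans⟩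

theorem upperProb_pr (rk : Fin 4 → ℕ) (p : Fin 4 → ℝ) (x : Fin 4) :
    upperProb (pr rk) p x = ∑ y, if rk y ≤ rk x then p y else 0 := by
  rw [upperProb, sum_filter]
  exact sum_congr rfl fun y _ => if_congr Iff.rfl rfl rfl

theorem IsLottery.sum_four {p : Fin 4 → ℝ} (hp : IsLottery p) :
    p 0 + p 1 + p 2 + p 3 = 1 := by
  simpa [Fin.sum_univ_four] using hp.2

theorem R11_eq_rankProfile :
    R11 = rankProfile ![![1,2,0,2], ![1,0,1,2], ![0,2,2,1], ![1,0,0,2]] := by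
  funext i
  fin_cases i <;> rfl

/-- In a profile of rank functions, `d` gets probability zero if `a` Pareto-dominates it. -/
theorem apply_d_eq_zero {f : (Fin 4 → Fin 4 → Fin 4 → Prop) → (Fin 4 → ℝ)}
    (hf : IsSDS f) (heff : SDEfficient f) (rk : Fin 4 → Fin 4 → ℕ)
    (h : ∀ i, rk i a ≤ rk i d) (h' : ∃ i, rk i a < rk i d) : f (rankProfile rk) d = 0 := by
  have hR := isProfile_rankProfile rk
  obtain ⟨i, hi⟩ := h'
  exact (heff _ hR).eq_zero_of_pareto_dominated (hf _ hR) hR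
    ⟨a, h, i, h i, not_le.2 hi⟩

/-- If a misreport of agent `i` weakly increases all upper probabilities of `i`, then it leaves
all of them unchanged. -/
theorem SDStrategyproof.upperProb_le {f : (Fin 4 → Fin 4 → Fin 4 → Prop) → (Fin 4 → ℝ)}
    (hsp : SDStrategyproof f) (rk rk' : Fin 4 → Fin 4 → ℕ) (i : Fin 4)
    (hne : ∀ j, j ≠ i → rk j = rk' j)
    (hge : ∀ x, upperProb (pr (rk i)) (f (rankProfile rk)) x ≤
      upperProb (pr (rk i)) (f (rankProfile rk')) x) (x : Fin 4) :
    upperProb (pr (rk i)) (f (rankProfile rk')) x ≤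
      upperProb (pr (rk i)) (f (rankProfile rk)) x := by
  have h := hsp (rankProfile rk) (rankProfile rk') (isProfile_rankProfile _)
    (isProfile_rankProfile _) i (fun j hj => congrArg pr (hne j hj))
  by_contra hx
  exact h ⟨hge, fun hle => hx (hle x)⟩

/-- A symmetry of the rank functions of a profile preserves the lottery chosen for it. -/
theorem apply_rankProfile_eq {f : (Fin 4 → Fin 4 → Fin 4 → Prop) → (Fin 4 → ℝ)}
    (han : Anonymous f) (hneu : Neutral f) (rk : Fin 4 → Fin 4 → ℕ) (π σ : Equiv.Perm (Fin 4))
    (h : ∀ i u v, rk (π i) (σ u) ≤ rk (π i) (σ v) ↔ rk i u ≤ rk i v) (x : Fin 4) :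
    f (rankProfile rk) (σ x) = f (rankProfile rk) x :=
  apply_eq_of_symmetry han hneu (isProfile_rankProfile rk) π σ h x

theorem stmt14 (f : (Fin 4 → Fin 4 → Fin 4 → Prop) → (Fin 4 → ℝ))
    (hf : IsSDS f) (han : Anonymous f) (hneu : Neutral f)
    (heff : SDEfficient f) (hsp : SDStrategyproof f) :
    f R11 d = 0 ∧ f R11 b ≥ 1/2 := by
  -- Starting from `R11`, each profile differs from the preceding one in one preference relation.
  set rk₀ : Fin 4 → Fin 4 → ℕ := ![![1,2,0,2], ![1,0,1,2], ![0,2,2,1], ![1,0,0,2]] with h₀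
  set rk₁ : Fin 4 → Fin 4 → ℕ := ![![1,2,0,2], ![1,0,2,2], ![0,2,2,1], ![1,0,0,2]] with h₁
  set rk₂ : Fin 4 → Fin 4 → ℕ := ![![1,2,0,2], ![1,0,2,2], ![0,2,2,1], ![1,0,0,1]] with h₂
  set rk₃ : Fin 4 → Fin 4 → ℕ := ![![1,2,0,2], ![1,0,2,2], ![0,1,1,0], ![1,0,0,1]] with h₃
  set rk₄ : Fin 4 → Fin 4 → ℕ := ![![1,2,0,2], ![0,0,1,2], ![0,1,1,0], ![1,0,0,1]] with h₄
  set rk₅ : Fin 4 → Fin 4 → ℕ := ![![1,2,0,0], ![0,0,1,2], ![0,1,1,0], ![1,0,0,1]] with h₅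
  have hlot (rk) := hf _ (isProfile_rankProfile rk)
  have hsum (rk) := (hlot rk).sum_four
  have hnonneg (rk) := (hlot rk).1
  have hd₀ : f (rankProfile rk₀) 3 = 0 := apply_d_eq_zero hf heff _ (by decide) (by decide)
  have hd₁ : f (rankProfile rk₁) 3 = 0 := apply_d_eq_zero hf heff _ (by decide) (by decide)
  have hd₂ : f (rankProfile rk₂) 3 = 0 := apply_d_eq_zero hf heff _ (by decide) (by decide)
  have hd₃ : f (rankProfile rk₃) 3 = 0 := apply_d_eq_zero hf heff _ (by decide) (by decide)
  have hd₄ : f (rankProfile rk₄) 3 = 0 := apply_d_eq_zero hf heff _ (by decide) (by decide)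
  have hbc₁ : f (rankProfile rk₁) 1 = f (rankProfile rk₁) 2 :=
    apply_rankProfile_eq han hneu rk₁ (Equiv.swap 0 1) (Equiv.swap 1 2) (by decide) 2
  have hbc₂ : f (rankProfile rk₂) 1 = f (rankProfile rk₂) 2 :=
    apply_rankProfile_eq han hneu rk₂ (Equiv.swap 0 1) (Equiv.swap 1 2) (by decide) 2
  have hbc₃ : f (rankProfile rk₃) 1 = f (rankProfile rk₃) 2 :=
    apply_rankProfile_eq han hneu rk₃ (Equiv.swap 0 1) (Equiv.swap 1 2) (by decide) 2
  have hac₅ : f (rankProfile rk₅) 0 = f (rankProfile rk₅) 2 :=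
    apply_rankProfile_eq han hneu rk₅ (Equiv.swap 0 1 * Equiv.swap 2 3)
      (Equiv.swap 0 2 * Equiv.swap 1 3) (by decide) 2
  have hbd₅ : f (rankProfile rk₅) 1 = f (rankProfile rk₅) 3 :=
    apply_rankProfile_eq han hneu rk₅ (Equiv.swap 0 1 * Equiv.swap 2 3)
      (Equiv.swap 0 2 * Equiv.swap 1 3) (by decide) 3
  have hb₅ : f (rankProfile rk₅) 1 = 0 := by
    set t := f (rankProfile rk₅) 1
    have ht0 : 0 ≤ t := hnonneg rk₅ 1
    have := (heff _ (isProfile_rankProfile rk₅)).upperProb_shift_le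
      (v := ![t, -t, t, -t]) (hlot rk₅)
      (fun x => by
        have := hnonneg rk₅ x
        fin_cases x <;> simp at * <;> linarith)
      (by simp [Fin.sum_univ_four])
      (fun i x => by
        fin_cases i <;> fin_cases x <;>
          simp [rankProfile, upperProb_pr, Fin.sum_univ_four, h₅, ht0]) 0 0
    simp [rankProfile, upperProb_pr, Fin.sum_univ_four, h₅] at this
    linarith
  have hc₄ : 1 / 2 ≤ f (rankProfile rk₄) 2 := by
    by_contra! hlt
    have := hsp.upperProb_le rk₄ rk₅ 0 (by decide) (fun x => by
      fin_cases x <;> simp [upperProb_pr, Fin.sum_univ_four, h₄] <;>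
        linarith [hsum rk₄, hsum rk₅, hnonneg rk₄ 0, hnonneg rk₄ 1, hnonneg rk₄ 2, hnonneg rk₅ 0]) 2
    simp [upperProb_pr, Fin.sum_univ_four, h₄] at this
    linarith [hsum rk₄, hsum rk₅, hnonneg rk₄ 0]
  have hb₃ : 1 / 2 ≤ f (rankProfile rk₃) 1 := by
    by_contra! hlt
    have := hsp.upperProb_le rk₄ rk₃ 1 (by decide) (fun x => by
      fin_cases x <;> simp [upperProb_pr, Fin.sum_univ_four, h₄] <;>
        linarith [hsum rk₄, hsum rk₃, hnonneg rk₄ 0, hnonneg rk₄ 1, hnonneg rk₄ 2, hnonneg rk₃ 0]) 0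
    simp [upperProb_pr, Fin.sum_univ_four, h₄] at this
    linarith [hsum rk₄, hsum rk₃, hnonneg rk₄ 0]
  have ha₂ : f (rankProfile rk₂) 0 ≤ 0 := by
    by_contra! hlt
    have := hsp.upperProb_le rk₃ rk₂ 2 (by decide) (fun x => by
      fin_cases x <;> simp [upperProb_pr, Fin.sum_univ_four, h₃] <;>
        linarith [hsum rk₃, hsum rk₂, hnonneg rk₃ 0, hnonneg rk₃ 1, hnonneg rk₃ 2, hnonneg rk₂ 0]) 0
    simp [upperProb_pr, Fin.sum_univ_four, h₃] at this
    linarith [hsum rk₃, hsum rk₂, hnonneg rk₃ 0]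
  have ha₁ : f (rankProfile rk₁) 0 ≤ 0 := by
    by_contra! hlt
    have := hsp.upperProb_le rk₁ rk₂ 3 (by decide) (fun x => by
      fin_cases x <;> simp [upperProb_pr, Fin.sum_univ_four, h₁] <;>
        linarith [hsum rk₁, hsum rk₂, hnonneg rk₁ 0, hnonneg rk₁ 1, hnonneg rk₁ 2, hnonneg rk₂ 0]) 1
    simp [upperProb_pr, Fin.sum_univ_four, h₁] at this
    linarith [hsum rk₁, hsum rk₂, hnonneg rk₁ 0]
  have hb₀ : 1 / 2 ≤ f (rankProfile rk₀) 1 := by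
    by_contra! hlt
    have := hsp.upperProb_le rk₀ rk₁ 1 (by decide) (fun x => by
      fin_cases x <;> simp [upperProb_pr, Fin.sum_univ_four, h₀] <;>
        linarith [hsum rk₀, hsum rk₁, hnonneg rk₀ 0, hnonneg rk₀ 1, hnonneg rk₀ 2, hnonneg rk₁ 0]) 1
    simp [upperProb_pr, Fin.sum_univ_four, h₀] at this
    linarith [hsum rk₀, hsum rk₁, hnonneg rk₀ 0]
  rw [R11_eq_rankProfile]
  exact ⟨hd₀, hb₀⟩
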